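/- arXiv:1607.08754 — 8 statements merged into one kernel-verified Lean document; each statement's English description precedes it below -/
import Mathlib

section
/- Let G be a finite simple graph with n vertices, let Π_p be a partial k-coloring of G with classes C_1,…,C_k, M := max_{1≤i≤k}|C_i| and t := |{i ∈ {1,…,k} : |C_i| = M}|, and let k̲ be a lower bound for the equitable chromatic number, i.e. k̲ ≤ χ_eq(G). If Π_p extends to an equitable k0-coloring for some k0 ≥ k, then n ≥ (M−1)·max{k̲, k} + t. -/
open Finset

variable {V : Type*}

/-- A `k`-coloring of `G`: `k` pairwise disjoint independent (possibly empty) classes covering `V`. -/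
def IsColoring (G : SimpleGraph V) (k : ℕ) (C : Fin k → Finset V) : Prop :=
  (∀ i j : Fin k, i ≠ j → Disjoint (C i) (C j)) ∧
  (∀ i : Fin k, ∀ v ∈ C i, ∀ w ∈ C i, ¬ G.Adj v w) ∧
  (∀ v : V, ∃ i : Fin k, v ∈ C i)

/-- A coloring is equitable if the sizes of any two color classes differ by at most one. -/
def IsEquitable {k : ℕ} (C : Fin k → Finset V) : Prop :=
  ∀ i j : Fin k, (C i).card ≤ (C j).card + 1

/-- A partial `k`-coloring of `G`: `k` pairwise disjoint independent classes. -/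
def IsPartialColoring (G : SimpleGraph V) (k : ℕ) (C : Fin k → Finset V) : Prop :=
  (∀ i j : Fin k, i ≠ j → Disjoint (C i) (C j)) ∧
  (∀ i : Fin k, ∀ v ∈ C i, ∀ w ∈ C i, ¬ G.Adj v w)

theorem stmt3 [Fintype V] (G : SimpleGraph V) (k : ℕ) (C : Fin k → Finset V)
    (hC : IsPartialColoring G k C)
    (M t : ℕ) (hM : M = univ.sup fun i : Fin k => (C i).card)
    (ht : t = ((univ : Finset (Fin k)).filter fun i => (C i).card = M).card)
    (klow : ℕ)
    (hlow : klow ≤ sInf {m : ℕ | ∃ D : Fin m → Finset V, IsColoring G m D ∧ IsEquitable D})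
    (hext : ∃ (k0 : ℕ) (hk : k ≤ k0) (D : Fin k0 → Finset V),
      IsColoring G k0 D ∧ IsEquitable D ∧ ∀ i : Fin k, C i ⊆ D (Fin.castLE hk i)) :
    ((M : ℤ) - 1) * ((max klow k : ℕ) : ℤ) + (t : ℤ) ≤ (Fintype.card V : ℤ) := by
  obtain ⟨k0, hk, D, hD, heq, hsub⟩ := hext
  have hk0 : max klow k ≤ k0 := max_le (hlow.trans (Nat.sInf_le ⟨D, hD, heq⟩)) hk
  have htk : t ≤ k := by
    rw [ht]
    exact (card_filter_le _ _).trans (by simp)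
  obtain rfl | hpos := Nat.eq_zero_or_pos M
  · have := le_max_right klow k
    push_cast
    omega
  have hne : (univ : Finset (Fin k)).Nonempty := by
    rw [nonempty_iff_ne_empty]
    intro h
    simp [h] at hM
    omega
  obtain ⟨i, -, hi⟩ := exists_mem_eq_sup univ hne fun i : Fin k => (C i).card
  have hsum : ∑ j, (D j).card ≤ Fintype.card V := by
    classical
    rw [← card_biUnion fun a _ b _ hab => hD.1 a b hab]
    exact card_le_univ _
  have hlarge (j : Fin k) (hj : (C j).card = M) : M ≤ (D (Fin.castLE hk j)).card :=
    hj ▸ card_le_card (hsub j)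
  have hsmall (j : Fin k0) : M - 1 ≤ (D j).card := by
    have := hlarge i (by rw [hM, hi])
    have := heq (Fin.castLE hk i) j
    omega
  let T := ((univ : Finset (Fin k)).filter fun i => (C i).card = M).map (Fin.castLEEmb hk)
  have hT : T.card = t := by rw [card_map, ht]
  have hbound : k0 * (M - 1) + t ≤ ∑ j, (D j).card := by
    calc k0 * (M - 1) + t = ∑ j : Fin k0, ((M - 1) + if j ∈ T then 1 else 0) := by
          simp [sum_add_distrib, hT]
      _ ≤ ∑ j, (D j).card := by
          refine sum_le_sum fun j _ => ?_
          split_ifs with hj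
          · obtain ⟨a, ha, rfl⟩ := mem_map.mp hj
            have := hlarge a (mem_filter.mp ha).2
            simp only [Fin.castLEEmb_apply]
            omega
          · exact hsmall j
  have hmul : (M - 1) * max klow k + t ≤ Fintype.card V := by
    have := Nat.mul_le_mul_left (M - 1) hk0
    rw [Nat.mul_comm k0] at hbound
    omega
  have hcast : ((M : ℤ) - 1) = ((M - 1 : ℕ) : ℤ) := by omega
  rw [hcast]
  exact_mod_cast hmul
end

section
/- Let G be a finite simple graph with n vertices, Π_p a partial k-coloring of G with classes C_1,…,C_k, and k0 ≥ k with M := max_{1≤i≤k}|C_i| ≤ ⌈n/k0⌉ (set C_i := ∅ for i > k). Suppose the uncolored set U is partitioned into disjoint sets U^1,…,U^l and α^1,…,α^l are integers with α^j ≥ α(G[U^j]), the stability number of the subgraph of G induced by U^j. If Π_p extends to an equitable k0-coloring, then there exists a map g : U → {1,…,k0} such that (i) g(v) ∈ F(v) for every v ∈ U, (ii) |{v ∈ U^j : g(v) = i}| ≤ α^j for every j ∈ {1,…,l} and every color i ∈ {1,…,k0}, and (iii) ⌊n/k0⌋ − |C_i| ≤ |{v ∈ U : g(v) = i}| ≤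 ⌈n/k0⌉ − |C_i| for every i ∈ {1,…,k0} (equivalently, the network N(G,Π_p,k0) admits an admissible integral flow of value |U|). -/
open Finset

variable {V : Type*}

/-- The classes extended to `k0` colors: `C i` for `i < k` and `∅` for `i ≥ k`. -/
def Cext (k k0 : ℕ) (C : Fin k → Finset V) : Fin k0 → Finset V :=
  fun i => if h : (i : ℕ) < k then C ⟨i, h⟩ else ∅

/-- The set `U` of uncolored vertices of a partial coloring. -/
def uncolored [Fintype V] [DecidableEq V] {k : ℕ} (C : Fin k → Finset V) : Finset V :=
  univ \ univ.biUnion fun i => C i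

/-- `F(v)`: the free colors of `v`, i.e. colors `i ≤ k0` such that `v` has no neighbor in `C i`. -/
def freeColors (G : SimpleGraph V) [DecidableRel G.Adj] (k k0 : ℕ)
    (C : Fin k → Finset V) (v : V) : Finset (Fin k0) :=
  univ.filter fun i : Fin k0 => ∀ w ∈ Cext k k0 C i, ¬ G.Adj v w

theorem IsColoring.sum_card [Fintype V] [DecidableEq V] {G : SimpleGraph V} {k : ℕ}
    {D : Fin k → Finset V} (hD : IsColoring G k D) : ∑ i, (D i).card = Fintype.card V := by
  rw [← card_biUnion fun i _ j _ hij => hD.1 i j hij, ← card_univ]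
  congr 1
  ext v
  simpa using hD.2.2 v

theorem IsEquitable.sum_div_le_card {k : ℕ} {D : Fin k → Finset V} (hD : IsEquitable D)
    (i : Fin k) : (∑ j, (D j).card) / k ≤ (D i).card := by
  have hlt : ∑ j, (D j).card < ∑ _j : Fin k, ((D i).card + 1) :=
    sum_lt_sum (fun j _ => hD j i) ⟨i, mem_univ i, Nat.lt_succ_self _⟩
  rw [sum_const, card_univ, Fintype.card_fin, smul_eq_mul] at hlt
  exact Nat.lt_succ_iff.mp (Nat.div_lt_of_lt_mul hlt)

theorem IsEquitable.card_le_sum_div {k : ℕ} {D : Fin k → Finset V} (hD : IsEquitable D)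
    (i : Fin k) : (D i).card ≤ (∑ j, (D j).card + k - 1) / k := by
  have hlt : ∑ _j : Fin k, (D i).card < ∑ j, ((D j).card + 1) :=
    sum_lt_sum (fun j _ => hD i j) ⟨i, mem_univ i, Nat.lt_succ_self _⟩
  rw [sum_add_distrib, sum_const, sum_const, card_univ, Fintype.card_fin, smul_eq_mul,
    smul_eq_mul, mul_one] at hlt
  rw [Nat.le_div_iff_mul_le i.pos, mul_comm]
  exact Nat.le_sub_one_of_lt hlt

theorem Cext_subset {k k0 : ℕ} (hk : k ≤ k0) {C : Fin k → Finset V} {D : Fin k0 → Finset V}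
    (h : ∀ i : Fin k, C i ⊆ D (Fin.castLE hk i)) (i : Fin k0) : Cext k k0 C i ⊆ D i := by
  unfold Cext
  split_ifs with hi
  · exact h ⟨i, hi⟩
  · exact empty_subset _

theorem mem_uncolored_iff [Fintype V] [DecidableEq V] {k k0 : ℕ} (hk : k ≤ k0)
    {C : Fin k → Finset V} {v : V} : v ∈ uncolored C ↔ ∀ i, v ∉ Cext k k0 C i := by
  simp only [uncolored, mem_sdiff, mem_univ, mem_biUnion, true_and, not_exists]
  refine ⟨fun h i => ?_, fun h i => ?_⟩
  · unfold Cext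
    split_ifs with hi
    · exact h _
    · exact notMem_empty v
  · simpa [Cext] using h (Fin.castLE hk i)

theorem stmt5 [Fintype V] [DecidableEq V] (G : SimpleGraph V) [DecidableRel G.Adj]
    (k k0 : ℕ) (hk : k ≤ k0) (C : Fin k → Finset V) (hC : IsPartialColoring G k C)
    (hM : (univ.sup fun i : Fin k => (C i).card) ≤ (Fintype.card V + k0 - 1) / k0)
    (l : ℕ) (P : Fin l → Finset V) (α : Fin l → ℕ)
    (hPdisj : ∀ j j' : Fin l, j ≠ j' → Disjoint (P j) (P j'))
    (hPcover : univ.biUnion P = uncolored C)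
    (hα : ∀ j : Fin l, ∀ S : Finset V, S ⊆ P j →
      (∀ v ∈ S, ∀ w ∈ S, v ≠ w → ¬ G.Adj v w) → S.card ≤ α j)
    (hext : ∃ D : Fin k0 → Finset V, IsColoring G k0 D ∧ IsEquitable D ∧
      ∀ i : Fin k, C i ⊆ D (Fin.castLE hk i)) :
    ∃ g : V → Fin k0,
      (∀ v ∈ uncolored C, g v ∈ freeColors G k k0 C v) ∧
      (∀ j : Fin l, ∀ i : Fin k0, ((P j).filter fun v => g v = i).card ≤ α j) ∧
      (∀ i : Fin k0,
        ((Fintype.card V / k0 : ℕ) : ℤ) - ((Cext k k0 C i).card : ℤ)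
            ≤ ((((uncolored C).filter fun v => g v = i)).card : ℤ) ∧
        ((((uncolored C).filter fun v => g v = i)).card : ℤ)
            ≤ (((Fintype.card V + k0 - 1) / k0 : ℕ) : ℤ) - ((Cext k k0 C i).card : ℤ)) := by
  obtain ⟨D, hD, hE, hCD⟩ := hext
  choose g hg using hD.2.2
  have hg_iff : ∀ v i, g v = i ↔ v ∈ D i := fun v i =>
    ⟨fun h => h ▸ hg v, fun h => by_contra fun hne =>
      disjoint_left.mp (hD.1 _ _ hne) (hg v) h⟩
  have hsub := Cext_subset hk hCD
  refine ⟨g, fun v _ => ?_, fun j i => ?_, fun i => ?_⟩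
  · simpa [freeColors] using fun w hw => hD.2.1 _ v (hg v) w (hsub _ hw)
  · refine hα j _ (filter_subset _ _) fun v hv w hw _ => ?_
    exact hD.2.1 i v ((hg_iff v i).mp (mem_filter.mp hv).2) w
      ((hg_iff w i).mp (mem_filter.mp hw).2)
  · have hclass : (uncolored C).filter (fun v => g v = i) = D i \ Cext k k0 C i := by
      ext v
      rw [mem_filter, mem_sdiff, mem_uncolored_iff hk, hg_iff]
      refine ⟨fun h => ⟨h.2, h.1 i⟩, fun h => ⟨fun j hj => ?_, h.1⟩⟩
      have hij : j = i := ((hg_iff v j).mpr (hsub j hj)).symm.trans ((hg_iff v i).mpr h.1)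
      exact h.2 (hij ▸ hj)
    have hcard := card_sdiff_add_card_eq_card (hsub i)
    have hlower := hE.sum_div_le_card i
    have hupper := hE.card_le_sum_div i
    rw [hD.sum_card] at hlower hupper
    rw [hclass]
    omega
end

section
/- Fix the network associated to a partial k-coloring Π_p of G, a number of colors k0 ≥ k, and a partition of the uncolored set U into U^0, U^1,…,U^l. The flow problem has an integral solution if and only if for all R_+, R_- ⊆ U, S_+, S_- ⊆ F and T_+, T_- ⊆ C satisfying δ⁺(R_+)∩S_- = δ⁺(R_-)∩S_+ = δ⁺(S_+)∩T_- = δ⁺(S_-)∩T_+ = ∅, the associated Hall condition holds: |R_-| + Σ_{i∈T_-}(|C_i| − ⌈n/k0⌉) ≤ |R_+| + Σ_{i∈T_+}(|C_i| − ⌊n/k0⌋) + e(R_-, F\S_-) + e(U\R_+, S_+) + e(S_-∩F^C, C\T_-) + |U^0|·e(S_-∩F^0, C\T_-) + e(F^C\S_+, T_+) + |U^0|·e(F^0\S_+, T_+). -/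
open Finset

variable {V : Type*}

/-- `δ⁺(v)`: the heads `(j,i)` of the `A2`-arcs leaving the uncolored vertex `v`;
an arc `(v,(j,i))` exists iff `v ∈ U^j` and `i ∈ F(v)`. -/
def outArcs [Fintype V] [DecidableEq V] (G : SimpleGraph V) [DecidableRel G.Adj]
    (k k0 l : ℕ) (C : Fin k → Finset V) (P : Fin (l + 1) → Finset V) (v : V) :
    Finset (Fin (l + 1) × Fin k0) :=
  univ.filter fun f => v ∈ P f.1 ∧ f.2 ∈ freeColors G k k0 C v

/-- `e(R,S)`: the number of `A2`-arcs from `R ⊆ U` to `S ⊆ F`. -/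
def eUF [Fintype V] [DecidableEq V] (G : SimpleGraph V) [DecidableRel G.Adj]
    (k k0 l : ℕ) (C : Fin k → Finset V) (P : Fin (l + 1) → Finset V)
    (R : Finset V) (S : Finset (Fin (l + 1) × Fin k0)) : ℕ :=
  ∑ v ∈ R, ((outArcs G k k0 l C P v) ∩ S).card

/-- `e(S,T)`: the number of `A3`-arcs from `S ⊆ F` to `T ⊆ C`
(each node `(j,i) ∈ F` has exactly one arc, to the color `i`). -/
def eFC {k0 l : ℕ} (S : Finset (Fin (l + 1) × Fin k0)) (T : Finset (Fin k0)) : ℕ :=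
  (S.filter fun f => f.2 ∈ T).card

/-- `F⁰`: the `F`-nodes of the part `U⁰`. -/
def F0 (k0 l : ℕ) : Finset (Fin (l + 1) × Fin k0) :=
  univ.filter fun f => f.1 = 0

/-- `F^C = F¹ ∪ … ∪ Fˡ`: the `F`-nodes of the cliques. -/
def FCl (k0 l : ℕ) : Finset (Fin (l + 1) × Fin k0) :=
  univ.filter fun f => f.1 ≠ 0

/-- `δ⁻(T)` for a set of colors `T`: all `F`-nodes `(j,i)` with `i ∈ T`. -/
def deltaMinus (k0 l : ℕ) (T : Finset (Fin k0)) : Finset (Fin (l + 1) × Fin k0) :=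
  univ.filter fun f => f.2 ∈ T

/-- The slack of the Hoffman cut condition at `W`: the upper bounds of the arcs leaving `W` minus
the lower bounds of the arcs entering `W`. -/
def cutSlack {N E : Type*} [DecidableEq N] [Fintype E] (s t : E → N) (lo up : E → ℤ)
    (W : Finset N) : ℤ :=
  ∑ e, ((if s e ∈ W ∧ t e ∉ W then up e else 0) - (if t e ∈ W ∧ s e ∉ W then lo e else 0))

section Circulation

variable {N E : Type*} [DecidableEq N] [Fintype E] (s t : E → N)

theorem cutSlack_update_up [DecidableEq E] (lo up : E → ℤ) (e : E) (W : Finset N) :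
    cutSlack s t lo (Function.update up e (up e - 1)) W =
      cutSlack s t lo up W - if s e ∈ W ∧ t e ∉ W then 1 else 0 := by
  have h : (if s e ∈ W ∧ t e ∉ W then (1 : ℤ) else 0) =
      ∑ e', if e' = e then (if s e ∈ W ∧ t e ∉ W then (1 : ℤ) else 0) else 0 := by simp
  rw [h, cutSlack, cutSlack, ← Finset.sum_sub_distrib]
  refine Finset.sum_congr rfl fun e' _ => ?_
  by_cases he : e' = e
  · subst he
    simp only [Function.update_self, if_true]
    split_ifs <;> ring
  · simp [he]

theorem cutSlack_update_lo [DecidableEq E] (lo up : E → ℤ) (e : E) (W : Finset N) :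
    cutSlack s t (Function.update lo e (lo e + 1)) up W =
      cutSlack s t lo up W - if t e ∈ W ∧ s e ∉ W then 1 else 0 := by
  have h : (if t e ∈ W ∧ s e ∉ W then (1 : ℤ) else 0) =
      ∑ e', if e' = e then (if t e ∈ W ∧ s e ∉ W then (1 : ℤ) else 0) else 0 := by simp
  rw [h, cutSlack, cutSlack, ← Finset.sum_sub_distrib]
  refine Finset.sum_congr rfl fun e' _ => ?_
  by_cases he : e' = e
  · subst he
    simp only [Function.update_self, if_true]
    split_ifs <;> ring
  · simp [he]

/-- Strict submodularity of the cut slack across an arc with room to spare. -/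
theorem cutSlack_inter_add_union_lt {lo up : E → ℤ} (hle : ∀ e, lo e ≤ up e) {e : E}
    (he : lo e < up e) {W W' : Finset N} (hs : s e ∈ W) (ht : t e ∉ W) (hs' : s e ∉ W')
    (ht' : t e ∈ W') :
    cutSlack s t lo up (W ∩ W') + cutSlack s t lo up (W ∪ W') <
      cutSlack s t lo up W + cutSlack s t lo up W' := by
  simp only [cutSlack, ← Finset.sum_add_distrib]
  refine Finset.sum_lt_sum (fun e' _ => ?_) ⟨e, Finset.mem_univ _, ?_⟩
  · have := hle e'
    by_cases h1 : s e' ∈ W <;> by_cases h2 : s e' ∈ W' <;> by_cases h3 : t e' ∈ W <;>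
      by_cases h4 : t e' ∈ W' <;> simp [h1, h2, h3, h4] <;> linarith
  · simp [hs, ht, hs', ht']
    linarith

theorem cutSlack_singleton (x : E → ℤ) (v : N) :
    cutSlack s t x x {v} =
      ∑ e, (if s e = v then x e else 0) - ∑ e, (if t e = v then x e else 0) := by
  rw [cutSlack, ← Finset.sum_sub_distrib]
  refine Finset.sum_congr rfl fun e _ => ?_
  by_cases h1 : s e = v <;> by_cases h2 : t e = v <;> simp [h1, h2]

theorem cutSlack_eq_sum_singleton (x : E → ℤ) (W : Finset N) :
    cutSlack s t x x W = ∑ v ∈ W, cutSlack s t x x {v} := by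
  simp only [cutSlack_singleton]
  rw [Finset.sum_sub_distrib, Finset.sum_comm, Finset.sum_comm (s := W), cutSlack,
    ← Finset.sum_sub_distrib]
  refine Finset.sum_congr rfl fun e _ => ?_
  by_cases h1 : s e ∈ W <;> by_cases h2 : t e ∈ W <;> simp [h1, h2]

theorem cutSlack_compl [Fintype N] (x : E → ℤ) (W : Finset N) :
    cutSlack s t x x Wᶜ = - cutSlack s t x x W := by
  rw [cutSlack, cutSlack, ← Finset.sum_neg_distrib]
  refine Finset.sum_congr rfl fun e _ => ?_
  by_cases h1 : s e ∈ W <;> by_cases h2 : t e ∈ W <;> simp [h1, h2]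

/-- **Hoffman's circulation theorem**, integral version. -/
theorem exists_circulation_iff [Fintype N] {lo up : E → ℤ} (hle : ∀ e, lo e ≤ up e) :
    (∃ x : E → ℤ, (∀ e, lo e ≤ x e ∧ x e ≤ up e) ∧
      ∀ v, ∑ e, (if s e = v then x e else 0) = ∑ e, (if t e = v then x e else 0)) ↔
    ∀ W, 0 ≤ cutSlack s t lo up W := by
  classical
  constructor
  · rintro ⟨x, hx, hcons⟩ W
    have h0 : cutSlack s t x x W = 0 := by
      rw [cutSlack_eq_sum_singleton]
      exact Finset.sum_eq_zero fun v _ => by rw [cutSlack_singleton, hcons, sub_self]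
    rw [← h0]
    refine Finset.sum_le_sum fun e _ => ?_
    have := hx e
    split_ifs <;> linarith
  · intro hcut
    obtain ⟨n, hn⟩ : ∃ n : ℕ, ∑ e, (up e - lo e) = n :=
      Int.eq_ofNat_of_zero_le (Finset.sum_nonneg fun e _ => sub_nonneg.2 (hle e))
    induction n generalizing lo up with
    | zero =>
      have heq : ∀ e, up e - lo e = 0 := fun e =>
        (Finset.sum_eq_zero_iff_of_nonneg fun e _ => sub_nonneg.2 (hle e)).1
          (by simpa using hn) e (Finset.mem_univ e)
      obtain rfl : lo = up := funext fun e => by linarith [heq e]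
      refine ⟨lo, fun e => ⟨le_rfl, le_rfl⟩, fun v => ?_⟩
      have h1 := hcut {v}
      have h2 := hcut {v}ᶜ
      rw [cutSlack_compl] at h2
      rw [cutSlack_singleton] at h1 h2
      linarith
    | succ n ih =>
      obtain ⟨e, he⟩ : ∃ e, lo e < up e := by
        by_contra! h
        have : ∑ e, (up e - lo e) ≤ 0 :=
          Finset.sum_nonpos fun e _ => sub_nonpos.2 (h e)
        rw [hn] at this
        push_cast at this
        linarith
      have hone : ∑ e', (if e' = e then (1 : ℤ) else 0) = 1 := by simp
      by_cases hup : ∀ W, 0 ≤ cutSlack s t lo (Function.update up e (up e - 1)) W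
      · obtain ⟨x, hx, hcons⟩ := ih (lo := lo) (up := Function.update up e (up e - 1))
          (fun e' => by
            by_cases h : e' = e
            · subst h; simp; linarith
            · simpa [h] using hle e') hup (by
            have : ∑ e', (Function.update up e (up e - 1) e' - lo e') =
                ∑ e', ((up e' - lo e') - if e' = e then (1 : ℤ) else 0) := by
              refine Finset.sum_congr rfl fun e' _ => ?_
              by_cases h : e' = e
              · subst h; simp; ring
              · simp [h]
            rw [this, Finset.sum_sub_distrib, hn, hone]
            push_cast
            ring)
        refine ⟨x, fun e' => ⟨(hx e').1, (hx e').2.trans ?_⟩, hcons⟩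
        by_cases h : e' = e
        · subst h; simp
        · simp [h]
      by_cases hlo : ∀ W, 0 ≤ cutSlack s t (Function.update lo e (lo e + 1)) up W
      · obtain ⟨x, hx, hcons⟩ := ih (lo := Function.update lo e (lo e + 1)) (up := up)
          (fun e' => by
            by_cases h : e' = e
            · subst h; simp; linarith
            · simpa [h] using hle e') hlo (by
            have : ∑ e', (up e' - Function.update lo e (lo e + 1) e') =
                ∑ e', ((up e' - lo e') - if e' = e then (1 : ℤ) else 0) := by
              refine Finset.sum_congr rfl fun e' _ => ?_
              by_cases h : e' = e
              · subst h; simp; ring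
              · simp [h]
            rw [this, Finset.sum_sub_distrib, hn, hone]
            push_cast
            ring)
        refine ⟨x, fun e' => ⟨le_trans ?_ (hx e').1, (hx e').2⟩, hcons⟩
        by_cases h : e' = e
        · subst h; simp
        · simp [h]
      push Not at hup hlo
      obtain ⟨W, hW⟩ := hup
      obtain ⟨W', hW'⟩ := hlo
      rw [cutSlack_update_up] at hW
      rw [cutSlack_update_lo] at hW'
      have h1 := hcut W
      have h2 := hcut W'
      have hm : s e ∈ W ∧ t e ∉ W := by
        by_contra h
        rw [if_neg h] at hW
        linarith
      have hm' : t e ∈ W' ∧ s e ∉ W' := by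
        by_contra h
        rw [if_neg h] at hW'
        linarith
      rw [if_pos hm] at hW
      rw [if_pos hm'] at hW'
      have h3 := cutSlack_inter_add_union_lt s t hle he hm.1 hm.2 hm'.2 hm'.1
      linarith [hcut (W ∩ W'), hcut (W ∪ W')]

end Circulation

/-- Feasibility of an integral flow in a three-layer network in which every node `f` of the middle
layer has a single outgoing arc, to `col f`. -/
theorem exists_layered_flow_iff {A F K : Type*} [Fintype A] [DecidableEq A] [Fintype F]
    [DecidableEq F] [Fintype K] [DecidableEq K] (col : F → K) {d : A → ℤ} {c₂ : A → F → ℤ}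
    {c₃ : F → ℤ} {a b : K → ℤ} (hc₂ : ∀ v f, 0 ≤ c₂ v f) (hc₃ : ∀ f, 0 ≤ c₃ f)
    (hab : ∀ i, a i ≤ b i) :
    (∃ (x₂ : A → F → ℤ) (x₃ : F → ℤ), (∀ v f, 0 ≤ x₂ v f ∧ x₂ v f ≤ c₂ v f) ∧
      (∀ f, 0 ≤ x₃ f ∧ x₃ f ≤ c₃ f) ∧ (∀ v, ∑ f, x₂ v f = d v) ∧
      (∀ f, x₃ f = ∑ v, x₂ v f) ∧
      ∀ i, a i ≤ ∑ f, (if col f = i then x₃ f else 0) ∧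
        ∑ f, (if col f = i then x₃ f else 0) ≤ b i) ↔
    (∀ (R : Finset A) (S : Finset F) (T : Finset K),
      ∑ v ∈ R, d v ≤ ∑ v ∈ R, ∑ f ∈ Sᶜ, c₂ v f + ∑ f ∈ S with col f ∉ T, c₃ f +
        ∑ i ∈ T, b i) ∧
    (∀ (R : Finset A) (S : Finset F) (T : Finset K),
      ∑ i ∈ T, a i ≤ ∑ v ∈ R, d v + ∑ v ∈ Rᶜ, ∑ f ∈ S, c₂ v f +
        ∑ f ∈ Sᶜ with col f ∈ T, c₃ f) := by
  let s : A ⊕ ((A × F) ⊕ (F ⊕ K)) → A ⊕ (F ⊕ (K ⊕ Unit)) :=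
    Sum.elim (fun _ => .inr (.inr (.inr ()))) (Sum.elim (fun p => .inl p.1)
      (Sum.elim (fun f => .inr (.inl f)) fun i => .inr (.inr (.inl i))))
  let t : A ⊕ ((A × F) ⊕ (F ⊕ K)) → A ⊕ (F ⊕ (K ⊕ Unit)) :=
    Sum.elim (fun v => .inl v) (Sum.elim (fun p => .inr (.inl p.2))
      (Sum.elim (fun f => .inr (.inr (.inl (col f)))) fun _ => .inr (.inr (.inr ()))))
  let lo : A ⊕ ((A × F) ⊕ (F ⊕ K)) → ℤ :=
    Sum.elim d (Sum.elim (fun _ => 0) (Sum.elim (fun _ => 0) a))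
  let up : A ⊕ ((A × F) ⊕ (F ⊕ K)) → ℤ :=
    Sum.elim d (Sum.elim (fun p => c₂ p.1 p.2) (Sum.elim c₃ b))
  have key := exists_circulation_iff s t (lo := lo) (up := up) (by
    rintro (v | p | f | i)
    · exact le_rfl
    · exact hc₂ _ _
    · exact hc₃ _
    · exact hab _)
  have hout (R : Finset A) (S : Finset F) (T : Finset K) :
      cutSlack s t lo up (R.disjSum (S.disjSum (T.disjSum ∅))) =
        ∑ v ∈ R, ∑ f ∈ Sᶜ, c₂ v f + ∑ f ∈ S with col f ∉ T, c₃ f + ∑ i ∈ T, b i -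
          ∑ v ∈ R, d v := by
    simp only [cutSlack, s, t, lo, up, Fintype.sum_sum_type, Fintype.sum_prod_type]
    simp [Finset.sum_filter, Finset.sum_ite_mem, ite_and, ← Finset.mem_compl]
    ring
  have hin (R : Finset A) (S : Finset F) (T : Finset K) :
      cutSlack s t lo up (Rᶜ.disjSum (Sᶜ.disjSum (Tᶜ.disjSum univ))) =
        ∑ v ∈ R, d v + ∑ v ∈ Rᶜ, ∑ f ∈ S, c₂ v f +
          ∑ f ∈ Sᶜ with col f ∈ T, c₃ f - ∑ i ∈ T, a i := by
    simp only [cutSlack, s, t, lo, up, Fintype.sum_sum_type, Fintype.sum_prod_type]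
    simp [Finset.sum_filter, Finset.sum_ite_mem, ite_and, ← Finset.mem_compl]
    ring
  have hcuts : (∀ W, 0 ≤ cutSlack s t lo up W) ↔
      (∀ (R : Finset A) (S : Finset F) (T : Finset K), 0 ≤ cutSlack s t lo up (R.disjSum (S.disjSum (T.disjSum ∅)))) ∧
      (∀ (R : Finset A) (S : Finset F) (T : Finset K), 0 ≤ cutSlack s t lo up (Rᶜ.disjSum (Sᶜ.disjSum (Tᶜ.disjSum univ)))) := by
    refine ⟨fun h => ⟨fun _ _ _ => h _, fun _ _ _ => h _⟩, fun h W => ?_⟩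
    by_cases hr : (.inr (.inr (.inr ())) : A ⊕ (F ⊕ (K ⊕ Unit))) ∈ W
    · convert h.2 W.toLeftᶜ W.toRight.toLeftᶜ W.toRight.toRight.toLeftᶜ using 1
      congr 1
      ext (v | f | i | _) <;> simp [hr]
    · convert h.1 W.toLeft W.toRight.toLeft W.toRight.toRight.toLeft using 1
      congr 1
      ext (v | f | i | _) <;> simp [hr]
  simp only [hout, hin, sub_nonneg] at hcuts
  rw [← hcuts, ← key]
  constructor
  · rintro ⟨x₂, x₃, h₂, h₃, hd, hx, hk⟩
    refine ⟨Sum.elim d (Sum.elim (fun p => x₂ p.1 p.2) (Sum.elim x₃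
      fun i => ∑ f, (if col f = i then x₃ f else 0))), ?_, ?_⟩
    · rintro (v | p | f | i)
      · exact ⟨le_rfl, le_rfl⟩
      · exact h₂ _ _
      · exact h₃ _
      · exact hk _
    · have htot : ∑ v, d v = ∑ i, ∑ f, (if col f = i then x₃ f else 0) := by
        rw [Finset.sum_comm]
        simp only [Finset.sum_ite_eq, Finset.mem_univ, if_true, ← hd, hx]
        exact Finset.sum_comm
      rintro (v | f | i | _)
      · simp [s, t, Fintype.sum_sum_type, Fintype.sum_prod_type_right, hd]
      · simp [s, t, Fintype.sum_sum_type, Fintype.sum_prod_type, hx]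
      · simp [s, t, Fintype.sum_sum_type]
      · simpa [s, t, Fintype.sum_sum_type] using htot
  · rintro ⟨x, hx, hcons⟩
    refine ⟨fun v f => x (.inr (.inl (v, f))), fun f => x (.inr (.inr (.inl f))),
      fun v f => hx _, fun f => hx _, fun v => ?_, fun f => ?_, fun i => ?_⟩
    · have h := hcons (.inl v)
      simp only [s, t, Fintype.sum_sum_type, Fintype.sum_prod_type_right] at h
      simp at h
      exact h.trans ((hx (.inl v)).2.antisymm (hx (.inl v)).1)
    · have h := hcons (.inr (.inl f))
      simp [s, t, Fintype.sum_sum_type, Fintype.sum_prod_type] at h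
      exact h
    · have h := hcons (.inr (.inr (.inl i)))
      simp [s, t, Fintype.sum_sum_type] at h
      simp only [← h]
      exact hx (.inr (.inr (.inr i)))

theorem natCast_eUF [Fintype V] [DecidableEq V] (G : SimpleGraph V) [DecidableRel G.Adj]
    (k k0 l : ℕ) (C : Fin k → Finset V) (P : Fin (l + 1) → Finset V) (R : Finset V)
    (S : Finset (Fin (l + 1) × Fin k0)) :
    (eUF G k k0 l C P R S : ℤ) =
      ∑ v ∈ R, ∑ f ∈ S, if f ∈ outArcs G k k0 l C P v then 1 else 0 := by
  rw [eUF, Nat.cast_sum]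
  refine Finset.sum_congr rfl fun v _ => ?_
  rw [Finset.sum_boole, Finset.inter_comm, ← Finset.filter_mem_eq_inter]

/-- The total capacity of the arcs from `S` to `T`, split into clique nodes and nodes of part `0`. -/
theorem eFC_FCl_add_eFC_F0 {k0 l : ℕ} (c : ℤ) (S : Finset (Fin (l + 1) × Fin k0))
    (T : Finset (Fin k0)) :
    (eFC (S ∩ FCl k0 l) T : ℤ) + c * (eFC (S ∩ F0 k0 l) T : ℤ) =
      ∑ f ∈ S with f.2 ∈ T, if f.1 ≠ 0 then 1 else c := by
  have h1 : {f ∈ S ∩ FCl k0 l | f.2 ∈ T} = {f ∈ {f ∈ S | f.2 ∈ T} | f.1 ≠ 0} := by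
    ext f
    simp [FCl, and_right_comm]
  have h2 : {f ∈ S ∩ F0 k0 l | f.2 ∈ T} = {f ∈ {f ∈ S | f.2 ∈ T} | ¬ f.1 ≠ 0} := by
    ext f
    simp [F0, and_right_comm]
  rw [Finset.sum_ite, Finset.sum_const, Finset.sum_const, eFC, eFC, h1, h2]
  simp only [nsmul_eq_mul]
  ring

theorem stmt8 [Fintype V] [DecidableEq V] (G : SimpleGraph V) [DecidableRel G.Adj]
    (k k0 l : ℕ) (hk : k ≤ k0) (C : Fin k → Finset V) (hC : IsPartialColoring G k C)
    (P : Fin (l + 1) → Finset V)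
    (hPdisj : ∀ j j' : Fin (l + 1), j ≠ j' → Disjoint (P j) (P j'))
    (hPcover : univ.biUnion P = uncolored C) :
    (∃ (x2 : V → Fin (l + 1) × Fin k0 → ℕ) (x3 : Fin (l + 1) × Fin k0 → ℕ),
      (∀ (v : V) (f : Fin (l + 1) × Fin k0), x2 v f ≠ 0 → f ∈ outArcs G k k0 l C P v) ∧
      (∀ v ∈ uncolored C, ∑ f : Fin (l + 1) × Fin k0, x2 v f = 1) ∧
      (∀ f : Fin (l + 1) × Fin k0, x3 f = ∑ v : V, x2 v f) ∧
      (∀ i : Fin k0,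
        ((Fintype.card V / k0 : ℕ) : ℤ) - ((Cext k k0 C i).card : ℤ)
            ≤ ((∑ j : Fin (l + 1), x3 (j, i) : ℕ) : ℤ) ∧
        ((∑ j : Fin (l + 1), x3 (j, i) : ℕ) : ℤ)
            ≤ (((Fintype.card V + k0 - 1) / k0 : ℕ) : ℤ) - ((Cext k k0 C i).card : ℤ)) ∧
      (∀ (v : V) (f : Fin (l + 1) × Fin k0), x2 v f ≤ 1) ∧
      (∀ f : Fin (l + 1) × Fin k0, f.1 ≠ 0 → x3 f ≤ 1) ∧
      (∀ i : Fin k0, x3 (0, i) ≤ (P 0).card)) ↔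
    (∀ (Rp Rm : Finset V) (Sp Sm : Finset (Fin (l + 1) × Fin k0)) (Tp Tm : Finset (Fin k0)),
      Rp ⊆ uncolored C → Rm ⊆ uncolored C →
      (∀ v ∈ Rp, Disjoint (outArcs G k k0 l C P v) Sm) →
      (∀ v ∈ Rm, Disjoint (outArcs G k k0 l C P v) Sp) →
      (∀ f ∈ Sp, f.2 ∉ Tm) →
      (∀ f ∈ Sm, f.2 ∉ Tp) →
      (Rm.card : ℤ) +
          ∑ i ∈ Tm, (((Cext k k0 C i).card : ℤ) - (((Fintype.card V + k0 - 1) / k0 : ℕ) : ℤ))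
        ≤ (Rp.card : ℤ) +
            ∑ i ∈ Tp, (((Cext k k0 C i).card : ℤ) - ((Fintype.card V / k0 : ℕ) : ℤ)) +
          (eUF G k k0 l C P Rm Smᶜ : ℤ) +
          (eUF G k k0 l C P (uncolored C \ Rp) Sp : ℤ) +
          (eFC (Sm ∩ FCl k0 l) Tmᶜ : ℤ) +
          ((P 0).card : ℤ) * (eFC (Sm ∩ F0 k0 l) Tmᶜ : ℤ) +
          (eFC (FCl k0 l \ Sp) Tp : ℤ) +
          ((P 0).card : ℤ) * (eFC (F0 k0 l \ Sp) Tp : ℤ)) := by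
  let d : V → ℤ := fun v => if v ∈ uncolored C then 1 else 0
  let c₂ : V → Fin (l + 1) × Fin k0 → ℤ := fun v f => if f ∈ outArcs G k k0 l C P v then 1 else 0
  let c₃ : Fin (l + 1) × Fin k0 → ℤ := fun f => if f.1 ≠ 0 then 1 else ((P 0).card : ℤ)
  let a : Fin k0 → ℤ := fun i =>
    ((Fintype.card V / k0 : ℕ) : ℤ) - ((Cext k k0 C i).card : ℤ)
  let b : Fin k0 → ℤ := fun i =>
    (((Fintype.card V + k0 - 1) / k0 : ℕ) : ℤ) - ((Cext k k0 C i).card : ℤ)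
  have hc₂ : ∀ v f, 0 ≤ c₂ v f := fun v f => by dsimp only [c₂]; split_ifs <;> simp
  have hc₃ : ∀ f, 0 ≤ c₃ f := fun f => by dsimp only [c₃]; split_ifs <;> simp
  have hab : ∀ i, a i ≤ b i := fun i => by
    have : 0 < k0 := i.pos
    exact sub_le_sub_right (Int.ofNat_le.2 (Nat.div_le_div_right (by omega))) _
  have hc₂U : ∀ v ∉ uncolored C, ∀ f, c₂ v f = 0 := fun v hv f => by
    refine if_neg fun hf => hv ?_
    rw [← hPcover, Finset.mem_biUnion]
    exact ⟨f.1, Finset.mem_univ _, (Finset.mem_filter.1 hf).2.1⟩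
  have hdR : ∀ R : Finset V, ∑ v ∈ R, d v = ((R ∩ uncolored C).card : ℤ) := fun R => by
    rw [Finset.sum_boole, Finset.filter_mem_eq_inter]
  have hcol (x : Fin (l + 1) × Fin k0 → ℤ) (i : Fin k0) :
      ∑ f, (if f.2 = i then x f else 0) = ∑ j, x (j, i) := by
    simp [Fintype.sum_prod_type]
  refine Iff.trans ?_ ((exists_layered_flow_iff (Prod.snd : Fin (l + 1) × Fin k0 → Fin k0)
    (d := d) hc₂ hc₃ hab).trans ?_)
  · constructor
    · rintro ⟨x₂, x₃, harc, hd, hx, hk, h₂, h₃, h₀⟩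
      refine ⟨fun v f => x₂ v f, fun f => x₃ f, fun v f => ⟨by positivity, ?_⟩,
        fun f => ⟨by positivity, ?_⟩, fun v => ?_, fun f => ?_, fun i => ?_⟩
      · dsimp only [c₂]
        split_ifs with h
        · exact_mod_cast h₂ v f
        · exact_mod_cast (not_imp_comm.1 (harc v f) h).le
      · dsimp only [c₃]
        split_ifs with h
        · exact_mod_cast h₃ f h
        · obtain ⟨j, i⟩ := f
          obtain rfl : j = 0 := not_not.1 h
          exact_mod_cast h₀ i
      · dsimp only [d]
        split_ifs with h
        · exact_mod_cast hd v h
        · refine Finset.sum_eq_zero fun f _ => ?_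
          have : f ∉ outArcs G k k0 l C P v := fun hf => by
            simpa [c₂, hf] using hc₂U v h f
          exact_mod_cast not_imp_comm.1 (harc v f) this
      · dsimp only
        exact_mod_cast hx f
      · rw [hcol]
        have := hk i
        push_cast at this
        exact this
    · rintro ⟨x₂, x₃, h₂, h₃, hd, hx, hk⟩
      lift x₂ to V → Fin (l + 1) × Fin k0 → ℕ using fun v f => (h₂ v f).1
      lift x₃ to Fin (l + 1) × Fin k0 → ℕ using fun f => (h₃ f).1
      refine ⟨x₂, x₃, fun v f hne => ?_, fun v hv => ?_, fun f => ?_, fun i => ?_, fun v f => ?_,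
        fun f hf => ?_, fun i => ?_⟩
      · by_contra hf
        have := (h₂ v f).2
        simp only [c₂, if_neg hf] at this
        exact hne (Nat.le_zero.1 (by exact_mod_cast this))
      · have := hd v
        simp only [d, if_pos hv] at this
        exact_mod_cast this
      · have := hx f
        dsimp only at this
        exact_mod_cast this
      · have := hk i
        rw [hcol] at this
        push_cast
        exact this
      · have hle : c₂ v f ≤ 1 := by dsimp only [c₂]; split_ifs <;> simp
        have := (h₂ v f).2.trans hle
        dsimp only at this
        exact_mod_cast this
      · have := (h₃ f).2
        simp only [c₃, if_pos hf] at this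
        exact_mod_cast this
      · have := (h₃ (0, i)).2
        simp [c₃] at this
        exact_mod_cast this
  · have hneg (p q : Fin k0 → ℤ) (T : Finset (Fin k0)) :
        ∑ i ∈ T, (p i - q i) = - ∑ i ∈ T, (q i - p i) := by
      rw [← Finset.sum_neg_distrib]
      exact Finset.sum_congr rfl fun i _ => (neg_sub _ _).symm
    have hFC (S : Finset (Fin (l + 1) × Fin k0)) (T : Finset (Fin k0)) :=
      eFC_FCl_add_eFC_F0 ((P 0).card : ℤ) S T
    have hCl (S : Finset (Fin (l + 1) × Fin k0)) : FCl k0 l \ S = Sᶜ ∩ FCl k0 l := by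
      rw [Finset.sdiff_eq_inter_compl, Finset.inter_comm]
    have h0 (S : Finset (Fin (l + 1) × Fin k0)) : F0 k0 l \ S = Sᶜ ∩ F0 k0 l := by
      rw [Finset.sdiff_eq_inter_compl, Finset.inter_comm]
    have hUF (R : Finset V) (S : Finset (Fin (l + 1) × Fin k0)) :
        (eUF G k k0 l C P R S : ℤ) = ∑ v ∈ R, ∑ f ∈ S, c₂ v f := natCast_eUF ..
    have hmono {R R' : Finset V} (h : R ⊆ R') (S : Finset (Fin (l + 1) × Fin k0)) :
        ∑ v ∈ R, ∑ f ∈ S, c₂ v f ≤ ∑ v ∈ R', ∑ f ∈ S, c₂ v f :=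
      Finset.sum_le_sum_of_subset_of_nonneg h fun v _ _ => Finset.sum_nonneg fun f _ => hc₂ v f
    have hE (S : Finset (Fin (l + 1) × Fin k0)) : eFC S ∅ = 0 := by simp [eFC]
    have hE' (T : Finset (Fin k0)) : eFC (∅ : Finset (Fin (l + 1) × Fin k0)) T = 0 := by
      simp [eFC]
    constructor
    · rintro ⟨hA, hB⟩ Rp Rm Sp Sm Tp Tm hRp hRm - - - -
      have h1 := hA Rm Sm Tm
      have h2 := hB Rp Sp Tp
      have h3 : ∑ v ∈ Rpᶜ, ∑ f ∈ Sp, c₂ v f = ∑ v ∈ uncolored C \ Rp, ∑ f ∈ Sp, c₂ v f := by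
        refine (Finset.sum_subset (fun v hv => ?_) fun v hv hv' => ?_).symm
        · exact Finset.mem_compl.2 (Finset.mem_sdiff.1 hv).2
        · refine Finset.sum_eq_zero fun f _ => hc₂U v (fun h => hv' ?_) f
          exact Finset.mem_sdiff.2 ⟨h, Finset.mem_compl.1 hv⟩
      rw [hdR, Finset.inter_eq_left.2 hRm] at h1
      rw [hdR, Finset.inter_eq_left.2 hRp, h3] at h2
      have h4 := hFC Sm Tmᶜ
      have h5 := hFC Spᶜ Tp
      simp only [Finset.mem_compl] at h4
      rw [hCl, h0, hUF, hUF, hneg _ _ Tm, hneg _ _ Tp]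
      linarith
    · intro h
      refine ⟨fun R S T => ?_, fun R S T => ?_⟩
      · have h1 := h ∅ (R ∩ uncolored C) ∅ S ∅ T (by simp) Finset.inter_subset_right
          (by simp) (by simp) (by simp) (by simp)
        have h2 := hmono (Finset.inter_subset_left (s₁ := R) (s₂ := uncolored C)) Sᶜ
        have h4 := hFC S Tᶜ
        simp only [Finset.mem_compl] at h4
        rw [hUF, hUF, hneg _ _ T] at h1
        simp only [hE, Finset.sum_empty, Finset.sum_const_zero, Finset.card_empty,
          Nat.cast_zero] at h1
        rw [hdR]
        linarith
      · have h1 := h (R ∩ uncolored C) ∅ S ∅ T ∅ Finset.inter_subset_right (by simp)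
          (by simp) (by simp) (by simp) (by simp)
        have h2 : ∑ v ∈ uncolored C \ (R ∩ uncolored C), ∑ f ∈ S, c₂ v f ≤
            ∑ v ∈ Rᶜ, ∑ f ∈ S, c₂ v f := hmono (fun v hv => by
              simp only [Finset.mem_sdiff, Finset.mem_inter, Finset.mem_compl] at hv ⊢
              tauto) S
        have h5 := hFC Sᶜ T
        rw [hCl, h0, hUF, hUF, hneg _ _ T] at h1
        simp only [Finset.empty_inter, hE', Finset.sum_empty, Finset.card_empty,
          Nat.cast_zero] at h1
        rw [hdR]
        linarith
end

section
/- Fix the network associated to a partial k-coloring Π_p of G, a number of colors k0 ≥ k, and a partition of the uncolored set U into U^0, U^1,…,U^l. Let T_+ ⊆ C be nonempty and for S ⊆ F define val(S) := |{v ∈ U : δ⁺(v)∩S ≠ ∅}| + e(F^C\S, T_+) + |U^0|·e(F^0\S, T_+). Then for every S ⊆ F there exists S' ⊆ F with S' ⊆ δ⁻(T_+) and S'∩F^0 = δ⁻(T_+)∩F^0 such that val(S') ≤ val(S); i.e., choices S_+ with S_+ ⊆ δ⁻(T_+) and S_+∩F^0 = δ⁻(T_+)∩F^0 dominate all other choices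 of S_+ in the positive Hall condition. -/
open Finset

variable {V : Type*}

theorem stmt11 [Fintype V] [DecidableEq V] (G : SimpleGraph V) [DecidableRel G.Adj]
    (k k0 l : ℕ) (hk : k ≤ k0) (C : Fin k → Finset V) (hC : IsPartialColoring G k C)
    (P : Fin (l + 1) → Finset V)
    (hPdisj : ∀ j j' : Fin (l + 1), j ≠ j' → Disjoint (P j) (P j'))
    (hPcover : univ.biUnion P = uncolored C)
    (Tp : Finset (Fin k0)) (hTp : Tp.Nonempty)
    (S : Finset (Fin (l + 1) × Fin k0)) :
    ∃ S' : Finset (Fin (l + 1) × Fin k0),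
      S' ⊆ deltaMinus k0 l Tp ∧
      S' ∩ F0 k0 l = deltaMinus k0 l Tp ∩ F0 k0 l ∧
      ((uncolored C).filter fun v => ((outArcs G k k0 l C P v) ∩ S').Nonempty).card
          + eFC (FCl k0 l \ S') Tp + (P 0).card * eFC (F0 k0 l \ S') Tp
        ≤ ((uncolored C).filter fun v => ((outArcs G k k0 l C P v) ∩ S).Nonempty).card
          + eFC (FCl k0 l \ S) Tp + (P 0).card * eFC (F0 k0 l \ S) Tp := by
  set S' := (S ∩ deltaMinus k0 l Tp) ∪ (deltaMinus k0 l Tp ∩ F0 k0 l) with hS'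
  have memS' : ∀ f, f ∈ S' ↔ f.2 ∈ Tp ∧ (f ∈ S ∨ f.1 = 0) := by
    intro f
    simp only [hS', mem_union, mem_inter, deltaMinus, F0, mem_filter, mem_univ, true_and]
    tauto
  have hCl : eFC (FCl k0 l \ S') Tp = eFC (FCl k0 l \ S) Tp := by
    unfold eFC
    congr 1
    ext f
    simp only [mem_filter, mem_sdiff, memS', FCl, mem_univ, true_and]
    tauto
  have h0 : eFC (F0 k0 l \ S') Tp = 0 := by
    unfold eFC
    rw [card_eq_zero, filter_eq_empty_iff]
    intro f
    simp only [mem_sdiff, memS', F0, mem_filter, mem_univ, true_and]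
    tauto
  refine ⟨S', ?_, ?_, ?_⟩
  · intro f hf
    simpa [deltaMinus] using ((memS' f).1 hf).1
  · ext f
    simp only [mem_inter, memS', deltaMinus, F0, mem_filter, mem_univ, true_and]
    tauto
  rw [hCl, h0]
  rcases Nat.eq_zero_or_pos (eFC (F0 k0 l \ S) Tp) with hz | hpos
  · have hsub : S' ⊆ S := by
      intro f hf
      obtain ⟨hT, hS | hf0⟩ := (memS' f).1 hf
      · exact hS
      · by_contra hn
        rw [eFC, card_eq_zero, filter_eq_empty_iff] at hz
        exact hz (mem_sdiff.2 ⟨by simp [F0, hf0], hn⟩) hT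
    rw [hz]
    gcongr
  · have hsub : ((uncolored C).filter fun v => ((outArcs G k k0 l C P v) ∩ S').Nonempty) ⊆
        ((uncolored C).filter fun v => ((outArcs G k k0 l C P v) ∩ S).Nonempty) ∪ P 0 := by
      intro v hv
      obtain ⟨hvU, f, hf⟩ := mem_filter.1 hv
      obtain ⟨hfo, hfS'⟩ := mem_inter.1 hf
      obtain ⟨-, hS | hf0⟩ := (memS' f).1 hfS'
      · exact mem_union_left _ (mem_filter.2 ⟨hvU, f, mem_inter.2 ⟨hfo, hS⟩⟩)
      · exact mem_union_right _ (hf0 ▸ (mem_filter.1 hfo).2.1)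
    have hcard := (card_le_card hsub).trans (card_union_le _ _)
    have hmul := Nat.le_mul_of_pos_right (P 0).card hpos
    omega
end

section
/- Fix the network associated to a partial k-coloring Π_p of G, a number of colors k0 ≥ k, and a partition of the uncolored set U into U^0, U^1,…,U^l. For a set S_- ⊆ F define R̄_- := {v ∈ U : δ⁺(v) ⊆ S_-}. Then e(R̄_-, F\S_-) = 0, and for every R ⊆ U one has |R| − e(R, F\S_-) ≤ |R̄_-|. Consequently, for fixed S_- ⊆ F and T_- ⊆ C, the negative Hall condition |R| + Σ_{i∈T_-}(|C_i| − ⌈n/k0⌉) ≤ e(R, F\S_-) + e(S_-∩F^C, C\T_-) + |U^0|·e(S_-∩F^0, C\T_-) for R = R̄_- implies the same condition for every R ⊆ U. -/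
open Finset

variable {V : Type*}

section

variable [Fintype V] [DecidableEq V] (G : SimpleGraph V) [DecidableRel G.Adj]
  (k k0 l : ℕ) (C : Fin k → Finset V) (P : Fin (l + 1) → Finset V)

theorem eUF_compl_eq_zero_iff (R : Finset V) (S : Finset (Fin (l + 1) × Fin k0)) :
    eUF G k k0 l C P R Sᶜ = 0 ↔ ∀ v ∈ R, outArcs G k k0 l C P v ⊆ S := by
  simp [eUF, ← sdiff_eq_inter_compl, sdiff_eq_empty_iff_subset]

/-- Each vertex of `R` with an out-arc leaving `S` contributes at least one arc to `e(R, Sᶜ)`. -/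
theorem card_le_card_filter_add_eUF (R : Finset V) (S : Finset (Fin (l + 1) × Fin k0)) :
    R.card ≤ (R.filter fun v => outArcs G k k0 l C P v ⊆ S).card + eUF G k k0 l C P R Sᶜ := by
  rw [card_filter, eUF, ← sum_add_distrib, card_eq_sum_ones]
  refine sum_le_sum fun v _ => ?_
  split_ifs with h
  · exact Nat.le_add_right _ _
  · rw [zero_add, Nat.one_le_iff_ne_zero, Ne, card_eq_zero, ← sdiff_eq_inter_compl,
      sdiff_eq_empty_iff_subset]
    exact h

end

theorem stmt12 [Fintype V] [DecidableEq V] (G : SimpleGraph V) [DecidableRel G.Adj]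
    (k k0 l : ℕ) (hk : k ≤ k0) (C : Fin k → Finset V) (hC : IsPartialColoring G k C)
    (P : Fin (l + 1) → Finset V)
    (hPdisj : ∀ j j' : Fin (l + 1), j ≠ j' → Disjoint (P j) (P j'))
    (hPcover : univ.biUnion P = uncolored C)
    (Sm : Finset (Fin (l + 1) × Fin k0)) (Tm : Finset (Fin k0))
    (Rbar : Finset V)
    (hRbar : Rbar = (uncolored C).filter fun v => outArcs G k k0 l C P v ⊆ Sm) :
    eUF G k k0 l C P Rbar Smᶜ = 0 ∧
    (∀ R : Finset V, R ⊆ uncolored C →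
      (R.card : ℤ) - (eUF G k k0 l C P R Smᶜ : ℤ) ≤ (Rbar.card : ℤ)) ∧
    (((Rbar.card : ℤ) +
          ∑ i ∈ Tm, (((Cext k k0 C i).card : ℤ) - (((Fintype.card V + k0 - 1) / k0 : ℕ) : ℤ))
        ≤ (eUF G k k0 l C P Rbar Smᶜ : ℤ) +
          (eFC (Sm ∩ FCl k0 l) Tmᶜ : ℤ) +
          ((P 0).card : ℤ) * (eFC (Sm ∩ F0 k0 l) Tmᶜ : ℤ)) →
      ∀ R : Finset V, R ⊆ uncolored C →
        (R.card : ℤ) +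
            ∑ i ∈ Tm, (((Cext k k0 C i).card : ℤ) - (((Fintype.card V + k0 - 1) / k0 : ℕ) : ℤ))
          ≤ (eUF G k k0 l C P R Smᶜ : ℤ) +
            (eFC (Sm ∩ FCl k0 l) Tmᶜ : ℤ) +
            ((P 0).card : ℤ) * (eFC (Sm ∩ F0 k0 l) Tmᶜ : ℤ)) := by
  have hzero : eUF G k k0 l C P Rbar Smᶜ = 0 := by
    rw [eUF_compl_eq_zero_iff, hRbar]
    exact fun v hv => (mem_filter.mp hv).2
  have hbound : ∀ R : Finset V, R ⊆ uncolored C →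
      (R.card : ℤ) - (eUF G k k0 l C P R Smᶜ : ℤ) ≤ (Rbar.card : ℤ) := by
    intro R hR
    have hcard := card_le_card_filter_add_eUF G k k0 l C P R Sm
    have hmono : (R.filter fun v => outArcs G k k0 l C P v ⊆ Sm).card ≤ Rbar.card := by
      rw [hRbar]
      exact card_le_card (filter_subset_filter _ hR)
    omega
  refine ⟨hzero, hbound, fun hHall R hR => ?_⟩
  have hR' := hbound R hR
  rw [hzero, Nat.cast_zero] at hHall
  linarith
end

section
/- Fix the network associated to a partial k-coloring Π_p of G, a number of colors k0 ≥ k, and a partition of the uncolored set U into U^0, U^1,…,U^l, and assume F(v) ≠ ∅ for every v ∈ U. Let S ⊆ F and set R̄_-(S) := {v ∈ U : δ⁺(v) ⊆ S}. If for every j ∈ {1,…,l} the atomic Hall inequality |{v ∈ U^j : δ⁺(v) ⊆ S∩F^j}| ≤ |S∩F^j| holds, then |R̄_-(S)| ≤ e(S∩F^C, C) + |U^0|·e(S∩F^0, C); that is, the Hall condition with T_- = ∅ is dominated by the atomic per-clique inequalities. -/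
open Finset

variable {V : Type*}

/-- An uncolored vertex of the part `P j` only has arcs to `F`-nodes of that part. -/
theorem fst_eq_of_mem_outArcs [Fintype V] [DecidableEq V] {G : SimpleGraph V}
    [DecidableRel G.Adj] {k k0 l : ℕ} {C : Fin k → Finset V} {P : Fin (l + 1) → Finset V}
    (hPdisj : ∀ j j' : Fin (l + 1), j ≠ j' → Disjoint (P j) (P j'))
    {j : Fin (l + 1)} {v : V} (hv : v ∈ P j) {f : Fin (l + 1) × Fin k0}
    (hf : f ∈ outArcs G k k0 l C P v) : f.1 = j := by
  by_contra hne
  exact disjoint_left.mp (hPdisj _ _ hne) (mem_filter.mp hf).2.1 hv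

/-- Every `F`-node has exactly one arc to the colors. -/
theorem eFC_univ {k0 l : ℕ} (S : Finset (Fin (l + 1) × Fin k0)) : eFC S univ = S.card := by
  simp [eFC]

/-- The clique nodes in `S` are counted part by part. -/
theorem card_inter_FCl {k0 l : ℕ} (S : Finset (Fin (l + 1) × Fin k0)) :
    (S ∩ FCl k0 l).card = ∑ j : Fin l, (S.filter fun f => f.1 = j.succ).card := by
  rw [card_eq_sum_card_fiberwise (f := Prod.fst) (t := univ) (by simp), Fin.sum_univ_succ]
  have hzero : (S ∩ FCl k0 l).filter (fun f => f.1 = 0) = ∅ := by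
    ext f
    simp only [FCl, mem_filter, mem_inter, mem_univ, true_and, notMem_empty, iff_false]
    tauto
  rw [hzero, card_empty, zero_add]
  refine sum_congr rfl fun j _ => congrArg card ?_
  ext f
  simp only [FCl, mem_filter, mem_inter, mem_univ, true_and]
  refine ⟨fun h => ⟨h.1.1, h.2⟩, fun h => ⟨⟨h.1, ?_⟩, h.2⟩⟩
  rw [h.2]
  exact Fin.succ_ne_zero j

theorem stmt13 [Fintype V] [DecidableEq V] (G : SimpleGraph V) [DecidableRel G.Adj]
    (k k0 l : ℕ) (hk : k ≤ k0) (C : Fin k → Finset V) (hC : IsPartialColoring G k C)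
    (P : Fin (l + 1) → Finset V)
    (hPdisj : ∀ j j' : Fin (l + 1), j ≠ j' → Disjoint (P j) (P j'))
    (hPcover : univ.biUnion P = uncolored C)
    (hfree : ∀ v ∈ uncolored C, (freeColors G k k0 C v).Nonempty)
    (S : Finset (Fin (l + 1) × Fin k0))
    (hatomic : ∀ j : Fin (l + 1), j ≠ 0 →
      ((P j).filter fun v => outArcs G k k0 l C P v ⊆ S.filter fun f => f.1 = j).card
        ≤ (S.filter fun f => f.1 = j).card) :
    ((uncolored C).filter fun v => outArcs G k k0 l C P v ⊆ S).card
      ≤ eFC (S ∩ FCl k0 l) univ + (P 0).card * eFC (S ∩ F0 k0 l) univ := by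
  rw [eFC_univ, eFC_univ, card_inter_FCl, ← hPcover, filter_biUnion]
  refine card_biUnion_le.trans ?_
  rw [Fin.sum_univ_succ, add_comm]
  refine add_le_add (sum_le_sum fun j _ => ?_) ?_
  · refine le_trans (card_le_card fun v hv => ?_) (hatomic j.succ (Fin.succ_ne_zero j))
    rw [mem_filter] at hv ⊢
    exact ⟨hv.1, fun f hf => mem_filter.mpr ⟨hv.2 hf, fst_eq_of_mem_outArcs hPdisj hv.1 hf⟩⟩
  · rcases ((P 0).filter fun v => outArcs G k k0 l C P v ⊆ S).eq_empty_or_nonempty with h | ⟨v, hv⟩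
    · rw [h, card_empty]
      exact Nat.zero_le _
    · rw [mem_filter] at hv
      obtain ⟨i, hi⟩ := hfree v (hPcover ▸ mem_biUnion.mpr ⟨0, mem_univ _, hv.1⟩)
      have hmem : ((0 : Fin (l + 1)), i) ∈ S ∩ F0 k0 l :=
        mem_inter.mpr ⟨hv.2 (mem_filter.mpr ⟨mem_univ _, hv.1, hi⟩),
          mem_filter.mpr ⟨mem_univ _, rfl⟩⟩
      exact (card_filter_le _ _).trans (Nat.le_mul_of_pos_right _ (card_pos.mpr ⟨_, hmem⟩))
end

section
/- Fix the network associated to a partial k-coloring Π_p of G, a number of colors k0 ≥ k, and a partition of the uncolored set U into U^0, U^1,…,U^l. Let T_- ⊆ C be nonempty and for S ⊆ F define lhs(S) := |{v ∈ U : δ⁺(v) ⊆ S}| + Σ_{i∈T_-}(|C_i| − ⌈n/k0⌉) and rhs(S) := e(S∩F^C, C\T_-) + |U^0|·e(S∩F^0, C\T_-). Then for every S ⊆ F there exists S' ⊆ F with S' ⊇ δ⁻(T_-) and S'∩F^0 = δ⁻(T_-)∩F^0 such that lhs(S) − rhs(S) ≤ lhs(S') − rhs(S'); i.e., choices S_-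 with S_- ⊇ δ⁻(T_-) and S_-∩F^0 = δ⁻(T_-)∩F^0 dominate all other choices of S_- in the negative Hall condition. -/
open Finset

variable {V : Type*}

theorem mem_FCl_of_mem_outArcs [Fintype V] [DecidableEq V] (G : SimpleGraph V)
    [DecidableRel G.Adj] (k k0 l : ℕ) (C : Fin k → Finset V) (P : Fin (l + 1) → Finset V)
    {v : V} (hv : v ∉ P 0) {f : Fin (l + 1) × Fin k0} (hf : f ∈ outArcs G k k0 l C P v) :
    f ∈ FCl k0 l := by
  simp only [outArcs, FCl, mem_filter, mem_univ, true_and] at hf ⊢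
  intro h0
  exact hv (h0 ▸ hf.1)

theorem stmt14 [Fintype V] [DecidableEq V] (G : SimpleGraph V) [DecidableRel G.Adj]
    (k k0 l : ℕ) (hk : k ≤ k0) (C : Fin k → Finset V) (hC : IsPartialColoring G k C)
    (P : Fin (l + 1) → Finset V)
    (hPdisj : ∀ j j' : Fin (l + 1), j ≠ j' → Disjoint (P j) (P j'))
    (hPcover : univ.biUnion P = uncolored C)
    (Tm : Finset (Fin k0)) (hTm : Tm.Nonempty)
    (S : Finset (Fin (l + 1) × Fin k0)) :
    ∃ S' : Finset (Fin (l + 1) × Fin k0),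
      deltaMinus k0 l Tm ⊆ S' ∧
      S' ∩ F0 k0 l = deltaMinus k0 l Tm ∩ F0 k0 l ∧
      ((((uncolored C).filter fun v => outArcs G k k0 l C P v ⊆ S).card : ℤ) +
            ∑ i ∈ Tm, (((Cext k k0 C i).card : ℤ) - (((Fintype.card V + k0 - 1) / k0 : ℕ) : ℤ)))
          - ((eFC (S ∩ FCl k0 l) Tmᶜ : ℤ) +
             ((P 0).card : ℤ) * (eFC (S ∩ F0 k0 l) Tmᶜ : ℤ))
        ≤ ((((uncolored C).filter fun v => outArcs G k k0 l C P v ⊆ S').card : ℤ) +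
              ∑ i ∈ Tm, (((Cext k k0 C i).card : ℤ) - (((Fintype.card V + k0 - 1) / k0 : ℕ) : ℤ)))
            - ((eFC (S' ∩ FCl k0 l) Tmᶜ : ℤ) +
               ((P 0).card : ℤ) * (eFC (S' ∩ F0 k0 l) Tmᶜ : ℤ)) := by
  refine ⟨deltaMinus k0 l Tm ∪ (S ∩ FCl k0 l), subset_union_left, ?_, ?_⟩
  · ext f
    simp only [mem_inter, mem_union, F0, FCl, deltaMinus, mem_filter, mem_univ, true_and]
    tauto
  set S' := deltaMinus k0 l Tm ∪ (S ∩ FCl k0 l) with hS'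
  have hclique : eFC (S' ∩ FCl k0 l) Tmᶜ = eFC (S ∩ FCl k0 l) Tmᶜ := by
    unfold eFC
    congr 1
    ext f
    simp only [hS', mem_inter, mem_union, FCl, deltaMinus, mem_filter, mem_univ, true_and,
      mem_compl]
    tauto
  have hzero : eFC (S' ∩ F0 k0 l) Tmᶜ = 0 := by
    unfold eFC
    rw [card_eq_zero, filter_eq_empty_iff]
    intro f
    simp only [hS', mem_inter, mem_union, F0, FCl, deltaMinus, mem_filter, mem_univ, true_and,
      mem_compl]
    tauto
  have hcount : ((uncolored C).filter fun v => outArcs G k k0 l C P v ⊆ S).card ≤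
      ((uncolored C).filter fun v => outArcs G k k0 l C P v ⊆ S').card +
        (P 0).card * eFC (S ∩ F0 k0 l) Tmᶜ := by
    rcases Nat.eq_zero_or_pos (eFC (S ∩ F0 k0 l) Tmᶜ) with he | he
    · have hSS' : S ⊆ S' := by
        intro f hf
        unfold eFC at he
        rw [card_eq_zero, filter_eq_empty_iff] at he
        have hf' := @he f
        simp only [hS', mem_inter, mem_union, F0, FCl, deltaMinus, mem_filter, mem_univ, true_and,
          mem_compl] at hf' ⊢
        tauto
      exact (card_le_card (monotone_filter_right _ fun v _ hv => hv.trans hSS')).trans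
        (Nat.le_add_right _ _)
    · have hsub : ((uncolored C).filter fun v => outArcs G k k0 l C P v ⊆ S) ⊆
          ((uncolored C).filter fun v => outArcs G k k0 l C P v ⊆ S') ∪ P 0 := by
        intro v hv
        rw [mem_filter] at hv
        by_cases hv0 : v ∈ P 0
        · exact mem_union_right _ hv0
        · refine mem_union_left _ (mem_filter.2 ⟨hv.1, fun f hf => mem_union_right _ ?_⟩)
          exact mem_inter.2 ⟨hv.2 hf, mem_FCl_of_mem_outArcs G k k0 l C P hv0 hf⟩
      exact (card_le_card hsub).trans ((card_union_le _ _).trans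
        (Nat.add_le_add_left (Nat.le_mul_of_pos_right _ he) _))
  rw [hclique, hzero]
  zify at hcount
  push_cast
  linarith
end

section
/- Let G be a finite simple graph with n vertices, Π_p a partial k-coloring of G with classes C_1,…,C_k (C_i := ∅ for i > k), uncolored set U, and let k0 ≥ k. If Π_p extends to an equitable k0-coloring, then for every set of colors T ⊆ {1,…,k0}: |{v ∈ U : F(v) ⊆ T}| ≤ Σ_{i∈T}(⌈n/k0⌉ − |C_i|). -/
open Finset

variable {V : Type*}

/-- A class of an equitable coloring has at most `⌈n / k⌉` elements. -/
theorem IsColoring.card_le_of_isEquitable [Fintype V] {G : SimpleGraph V} {k : ℕ}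
    {D : Fin k → Finset V} (hD : IsColoring G k D) (hE : IsEquitable D) (i : Fin k) :
    (D i).card ≤ (Fintype.card V + k - 1) / k := by
  classical
  have hk : 0 < k := i.pos
  have hcard : Fintype.card V = ∑ j, (D j).card := by
    rw [← card_biUnion fun a _ b _ hab => hD.1 a b hab, ← card_univ]
    congr 1
    ext v
    simpa using hD.2.2 v
  have h : ∑ _j : Fin k, (D i).card < ∑ j, ((D j).card + 1) :=
    sum_lt_sum (fun j _ => hE i j) ⟨i, mem_univ i, Nat.lt_succ_self _⟩
  rw [Nat.le_div_iff_mul_le hk, mul_comm]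
  rw [sum_add_distrib, ← hcard] at h
  simp only [sum_const, card_univ, Fintype.card_fin, smul_eq_mul, mul_one] at h
  omega

theorem notMem_Cext_of_mem_uncolored [Fintype V] [DecidableEq V] {k : ℕ} (k0 : ℕ)
    {C : Fin k → Finset V} {v : V} (hv : v ∈ uncolored C) (i : Fin k0) :
    v ∉ Cext k k0 C i := by
  have hv' : ∀ j, v ∉ C j := by simpa [uncolored] using hv
  unfold Cext
  split_ifs
  · exact hv' _
  · exact notMem_empty v

theorem stmt18 [Fintype V] [DecidableEq V] (G : SimpleGraph V) [DecidableRel G.Adj]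
    (k k0 : ℕ) (hk : k ≤ k0) (C : Fin k → Finset V) (hC : IsPartialColoring G k C)
    (hext : ∃ D : Fin k0 → Finset V, IsColoring G k0 D ∧ IsEquitable D ∧
      ∀ i : Fin k, C i ⊆ D (Fin.castLE hk i)) :
    ∀ T : Finset (Fin k0),
      ((((uncolored C).filter fun v => freeColors G k k0 C v ⊆ T)).card : ℤ)
        ≤ ∑ i ∈ T, ((((Fintype.card V + k0 - 1) / k0 : ℕ) : ℤ) - ((Cext k k0 C i).card : ℤ)) := by
  obtain ⟨D, hD, hE, hCD⟩ := hext
  intro T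
  have hsub := Cext_subset hk hCD
  have hcover : ((uncolored C).filter fun v => freeColors G k k0 C v ⊆ T) ⊆
      T.biUnion fun i => D i \ Cext k k0 C i := by
    intro v hv
    obtain ⟨hvU, hvT⟩ := mem_filter.mp hv
    obtain ⟨i, hi⟩ := hD.2.2 v
    have hfree : i ∈ freeColors G k k0 C v := by
      simpa [freeColors] using fun w hw => hD.2.1 i v hi w (hsub i hw)
    exact mem_biUnion.mpr
      ⟨i, hvT hfree, mem_sdiff.mpr ⟨hi, notMem_Cext_of_mem_uncolored k0 hvU i⟩⟩
  calc ((((uncolored C).filter fun v => freeColors G k k0 C v ⊆ T)).card : ℤ)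
      ≤ ∑ i ∈ T, ((D i \ Cext k k0 C i).card : ℤ) := by
        exact_mod_cast (card_le_card hcover).trans card_biUnion_le
    _ ≤ _ := sum_le_sum fun i _ => by
        rw [cast_card_sdiff (hsub i)]
        exact sub_le_sub_right (by exact_mod_cast hD.card_le_of_isEquitable hE i) _
end
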